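/- For every integer k with 1 ≤ k ≤ d−1, the degree from below of the vertex p(U_d^k) of the White Whale H_∞^+(d,1) equals C(d−1, k−1); that is, the number of vectors g ∈ U_d^k such that p(U_d^k \ {g}) is a vertex of H_∞^+(d,1) equals the binomial coefficient C(d−1, k−1). -/

import Mathlib

/-- The set `G_d` of generators of the White Whale:
all nonzero 0/1-valued vectors of `ℝ^d`. -/
def whaleGens (d : ℕ) : Set (Fin d → ℝ) :=
  {g | g ≠ 0 ∧ ∀ i, g i = 0 ∨ g i = 1}

/-- The point `p(S)`: the sum of the vectors in `S` (with `p(∅) = 0`). -/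
noncomputable def whaleSum {d : ℕ} (S : Set (Fin d → ℝ)) : Fin d → ℝ :=
  ∑ᶠ g ∈ S, g

/-- The White Whale `H_∞^+(d,1)`: the convex hull of the points `p(S)`
over all subsets `S ⊆ G_d`. -/
noncomputable def whiteWhale (d : ℕ) : Set (Fin d → ℝ) :=
  convexHull ℝ {x | ∃ S : Set (Fin d → ℝ), S ⊆ whaleGens d ∧ x = whaleSum S}

/-- A vertex of the White Whale is an extreme point of it. -/
def IsWhaleVertex (d : ℕ) (x : Fin d → ℝ) : Prop :=
  x ∈ Set.extremePoints ℝ (whiteWhale d)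

/-- The set U_d^k: vectors of G_d whose last coordinate is 1 and which have
at most k nonzero coordinates. -/
def whaleU (d k : ℕ) (hd : 0 < d) : Set (Fin d → ℝ) :=
  {g | g ∈ whaleGens d ∧ g ⟨d - 1, Nat.sub_lt hd one_pos⟩ = 1 ∧
       {i : Fin d | g i ≠ 0}.ncard ≤ k}

theorem mem_extremePoints_convexHull_of_forall_lt {E : Type*} [AddCommGroup E] [Module ℝ E]
    {P : Set E} {x : E} (hx : x ∈ P) (f : E →ₗ[ℝ] ℝ) (h : ∀ y ∈ P, y ≠ x → f y < f x) :
    x ∈ Set.extremePoints ℝ (convexHull ℝ P) := by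
  have hconv : Convex ℝ {y | y ≠ x → f y < f x} := by
    rw [convex_iff_forall_pos]
    intro y hy z hz a b ha hb hab hne
    have hle : ∀ w, (w ≠ x → f w < f x) → f w ≤ f x := fun w hw => by
      by_cases hwx : w = x
      · rw [hwx]
      · exact (hw hwx).le
    have hfx : f x = a * f x + b * f x := by rw [← add_mul, hab, one_mul]
    rw [map_add, map_smul, map_smul, smul_eq_mul, smul_eq_mul, hfx]
    by_cases hyx : y = x
    · have hzx : z ≠ x := by
        rintro rfl
        exact hne (by rw [hyx, ← add_smul, hab, one_smul])
      exact add_lt_add_of_le_of_lt (mul_le_mul_of_nonneg_left (hle y hy) ha.le)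
        (mul_lt_mul_of_pos_left (hz hzx) hb)
    · exact add_lt_add_of_lt_of_le (mul_lt_mul_of_pos_left (hy hyx) ha)
        (mul_le_mul_of_nonneg_left (hle z hz) hb.le)
  have hsub : convexHull ℝ P ⊆ {y | y ≠ x → f y < f x} := convexHull_min h hconv
  refine mem_extremePoints.2 ⟨subset_convexHull ℝ P hx, fun y hy z hz hseg => ?_⟩
  obtain ⟨a, b, ha, hb, hab, hxe⟩ := hseg
  have hfx : a * f y + b * f z = a * f x + b * f x := by
    rw [← add_mul, hab, one_mul, ← hxe]
    simp
  have hy' := hsub hy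
  have hz' := hsub hz
  simp only [Set.mem_ofPred_eq] at hy' hz'
  by_cases hyx : y = x <;> by_cases hzx : z = x
  · exact ⟨hyx, hzx⟩
  · subst hyx
    nlinarith [hz' hzx]
  · subst hzx
    nlinarith [hy' hyx]
  · nlinarith [hy' hyx, hz' hzx]

theorem finite_whaleGens (d : ℕ) : (whaleGens d).Finite :=
  (Set.Finite.pi' fun _ : Fin d => Set.toFinite ({0, 1} : Set ℝ)).subset fun _ hg => hg.2

theorem isWhaleVertex_whaleSum_of_separated {d : ℕ} {S : Set (Fin d → ℝ)} (hS : S ⊆ whaleGens d)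
    (f : (Fin d → ℝ) →ₗ[ℝ] ℝ) (hpos : ∀ g ∈ S, 0 < f g)
    (hneg : ∀ g ∈ whaleGens d, g ∉ S → f g < 0) : IsWhaleVertex d (whaleSum S) := by
  classical
  refine mem_extremePoints_convexHull_of_forall_lt ⟨S, hS, rfl⟩ f ?_
  rintro _ ⟨T, hT, rfl⟩ hne
  have hsum : ∀ R ⊆ whaleGens d,
      f (whaleSum R) = ∑ g ∈ (finite_whaleGens d).toFinset, if g ∈ R then f g else 0 := by
    intro R hR
    rw [whaleSum, finsum_mem_eq_finite_toFinset_sum _ ((finite_whaleGens d).subset hR), map_sum,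
      ← Finset.sum_filter]
    refine Finset.sum_congr ?_ fun _ _ => rfl
    ext g
    simpa using fun hg => hR hg
  rw [hsum T hT, hsum S hS]
  refine Finset.sum_lt_sum (fun g hg => ?_) ?_
  · have hg' : g ∈ whaleGens d := by simpa using hg
    have h1 := hpos g
    have h2 := hneg g hg'
    grind
  · obtain ⟨g, hg⟩ : ∃ g, ¬ (g ∈ T ↔ g ∈ S) := by
      by_contra! hall
      exact hne (by rw [Set.ext hall])
    have hg' : g ∈ whaleGens d := by
      by_cases h : g ∈ S
      · exact hS h
      · exact hT (by tauto)
    have h1 := hpos g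
    have h2 := hneg g hg'
    exact ⟨g, by simpa using hg', by grind⟩

theorem not_isWhaleVertex_whaleSum {d : ℕ} {S : Set (Fin d → ℝ)} (hS : S ⊆ whaleGens d)
    {g e : Fin d → ℝ} (hg : g ∈ whaleGens d) (he : e ∈ whaleGens d) (hge : g ≠ e)
    (hgS : g ∉ S) (heS : e ∉ S) (hmem : g + e ∈ S) : ¬ IsWhaleVertex d (whaleSum S) := by
  intro hv
  have hfin := (finite_whaleGens d).subset hS
  have hadd : whaleSum (insert g (insert e S)) = g + (e + whaleSum S) := by
    rw [whaleSum, finsum_mem_insert _ (by simp [hge, hgS]) (hfin.insert e),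
      finsum_mem_insert _ heS hfin, whaleSum]
  have hdiff : (g + e) + whaleSum (S \ {g + e}) = whaleSum S := by
    conv_rhs => rw [← Set.insert_sdiff_self_of_mem hmem]
    rw [whaleSum, whaleSum, finsum_mem_insert _ (by simp) (hfin.subset Set.sdiff_subset)]
  have h := (mem_extremePoints.1 hv).2 (whaleSum (insert g (insert e S)))
    (subset_convexHull ℝ _ ⟨_, by
      rintro x (rfl | rfl | hx)
      exacts [hg, he, hS hx], rfl⟩)
    (whaleSum (S \ {g + e})) (subset_convexHull ℝ _ ⟨_, Set.sdiff_subset.trans hS, rfl⟩)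
    ⟨1 / 2, 1 / 2, by norm_num, by norm_num, by norm_num, by
      rw [hadd, ← hdiff]
      module⟩
  refine (hS hmem).1 ?_
  have h2 := h.2
  rw [← hdiff] at h2
  simpa using h2

theorem mem_whaleGens_iff {d : ℕ} {g : Fin d → ℝ} :
    g ∈ whaleGens d ↔ ∃ B : Finset (Fin d), B.Nonempty ∧ g = (B : Set (Fin d)).indicator 1 := by
  classical
  constructor
  · rintro ⟨h0, h⟩
    refine ⟨Finset.univ.filter (g · = 1), ?_, ?_⟩
    · obtain ⟨i, hi⟩ := Function.ne_iff.1 h0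
      exact ⟨i, by simpa using (h i).resolve_left hi⟩
    · ext i
      rcases h i with hi | hi <;> simp [hi]
  · rintro ⟨B, ⟨i, hi⟩, rfl⟩
    refine ⟨fun h => ?_, fun j => ?_⟩
    · simpa [hi] using congrFun h i
    · by_cases hj : j ∈ B <;> simp [hj]

theorem indicator_one_injective (d : ℕ) :
    Function.Injective fun B : Finset (Fin d) =>
      ((B : Set (Fin d)).indicator 1 : Fin d → ℝ) := by
  intro B C h
  exact Finset.coe_injective (Set.indicator_one_inj ℝ h)

theorem indicator_mem_whaleU_iff {d k : ℕ} (hd : 0 < d) (B : Finset (Fin d)) :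
    ((B : Set (Fin d)).indicator 1 : Fin d → ℝ) ∈ whaleU d k hd ↔
      (⟨d - 1, Nat.sub_lt hd one_pos⟩ : Fin d) ∈ B ∧ B.card ≤ k := by
  have hsupp : {i : Fin d | ((B : Set (Fin d)).indicator 1 : Fin d → ℝ) i ≠ 0} = B := by
    ext i
    simp
  rw [whaleU, Set.mem_ofPred_eq, hsupp, Set.ncard_coe_finset]
  have hlast : ((B : Set (Fin d)).indicator 1 : Fin d → ℝ) ⟨d - 1, Nat.sub_lt hd one_pos⟩ = 1 ↔
      (⟨d - 1, Nat.sub_lt hd one_pos⟩ : Fin d) ∈ B := by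
    simp [Set.indicator_apply]
  rw [hlast]
  exact ⟨fun h => h.2, fun h => ⟨mem_whaleGens_iff.2 ⟨B, ⟨_, h.1⟩, rfl⟩, h⟩⟩

theorem isWhaleVertex_whaleU_diff {d k : ℕ} (hd : 0 < d) {B₀ : Finset (Fin d)}
    (hmem : (⟨d - 1, Nat.sub_lt hd one_pos⟩ : Fin d) ∈ B₀) (hcard : B₀.card = k) :
    IsWhaleVertex d (whaleSum (whaleU d k hd \ {(B₀ : Set (Fin d)).indicator 1})) := by
  classical
  set l : Fin d := ⟨d - 1, Nat.sub_lt hd one_pos⟩ with hl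
  let c : Fin d → ℝ := fun i =>
    -2 * k + (if i ∈ B₀ then -2 else 0) + if i = l then 2 * (k : ℝ) ^ 2 + 2 * k - 1 else 0
  let f : (Fin d → ℝ) →ₗ[ℝ] ℝ := ∑ i, c i • LinearMap.proj i
  have hf : ∀ B : Finset (Fin d), f ((B : Set (Fin d)).indicator 1) =
      ((-2 * (k : ℤ) * B.card - 2 * (B ∩ B₀).card +
        if l ∈ B then 2 * (k : ℤ) ^ 2 + 2 * k - 1 else 0 : ℤ) : ℝ) := by
    intro B
    have : f ((B : Set (Fin d)).indicator 1) = ∑ i ∈ B, c i := by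
      simp [f, Set.indicator_apply]
    rw [this]
    simp only [c, Finset.sum_add_distrib, Finset.sum_const, Finset.sum_ite_eq', nsmul_eq_mul,
      ← Finset.sum_filter, Finset.filter_mem_eq_inter]
    push_cast
    ring
  have hk : 1 ≤ k := hcard ▸ Finset.card_pos.2 ⟨l, hmem⟩
  refine isWhaleVertex_whaleSum_of_separated (fun g hg => hg.1.1) f ?_ ?_
  · rintro g ⟨hgU, hgne⟩
    obtain ⟨B, -, rfl⟩ := mem_whaleGens_iff.1 hgU.1
    obtain ⟨hlB, hB⟩ := (indicator_mem_whaleU_iff hd B).1 hgU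
    rw [← hl] at hlB
    have hne : B ≠ B₀ := fun h => hgne (by rw [h]; rfl)
    rw [hf, if_pos hlB]
    refine Int.cast_pos.2 ?_
    have h1 : (B ∩ B₀).card ≤ B.card := Finset.card_le_card Finset.inter_subset_left
    rcases hB.lt_or_eq with hlt | heq
    · nlinarith
    · have h2 : (B ∩ B₀).card < B.card := by
        refine Finset.card_lt_card (Finset.ssubset_iff_subset_ne.2
          ⟨Finset.inter_subset_left, fun h => hne ?_⟩)
        exact Finset.eq_of_subset_of_card_le (Finset.inter_eq_left.1 h) (by omega)
      rw [heq] at h2 ⊢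
      nlinarith
  · intro g hg hgS
    obtain ⟨B, hBne, rfl⟩ := mem_whaleGens_iff.1 hg
    rw [hf]
    refine Int.cast_lt_zero.2 ?_
    have hBpos := Finset.card_pos.2 hBne
    split_ifs with hlB
    · by_cases hB : B = B₀
      · rw [hB, Finset.inter_self, hcard]
        nlinarith
      · have hlt : k < B.card := by
          by_contra! hle
          exact hgS ⟨(indicator_mem_whaleU_iff hd B).2 ⟨hlB, hle⟩,
            fun h => hB (indicator_one_injective d h)⟩
        have hpos : 0 < (B ∩ B₀).card :=
          Finset.card_pos.2 ⟨l, Finset.mem_inter.2 ⟨hlB, hmem⟩⟩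
        nlinarith
    · nlinarith

theorem not_isWhaleVertex_whaleU_diff {d k : ℕ} (hd : 0 < d) (hkd : k ≤ d) {B : Finset (Fin d)}
    (hmem : (⟨d - 1, Nat.sub_lt hd one_pos⟩ : Fin d) ∈ B) (hcard : B.card < k) :
    ¬ IsWhaleVertex d (whaleSum (whaleU d k hd \ {(B : Set (Fin d)).indicator 1})) := by
  classical
  obtain ⟨i, hi⟩ : ∃ i, i ∉ B := by
    by_contra! h
    rw [Finset.eq_univ_iff_forall.2 h, Finset.card_univ, Fintype.card_fin] at hcard
    omega
  have hsum : ((B : Set (Fin d)).indicator 1 : Fin d → ℝ) +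
      ((({i} : Finset (Fin d)) : Set (Fin d)).indicator 1) =
      ((insert i B : Finset (Fin d)) : Set (Fin d)).indicator 1 := by
    ext j
    by_cases hj : j = i
    · subst hj
      simp [hi]
    · simp [Set.indicator_apply, hj]
  have hBi : B ≠ {i} := by
    rintro rfl
    simp at hi
  refine not_isWhaleVertex_whaleSum (fun g hg => hg.1.1)
    (mem_whaleGens_iff.2 ⟨B, ⟨_, hmem⟩, rfl⟩)
    (mem_whaleGens_iff.2 ⟨{i}, Finset.singleton_nonempty i, rfl⟩)
    (fun h => hBi (indicator_one_injective d h)) (by simp) (fun h => ?_) ?_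
  · have := ((indicator_mem_whaleU_iff hd _).1 h.1).1
    rw [Finset.mem_singleton] at this
    exact hi (this ▸ hmem)
  · rw [hsum]
    refine ⟨(indicator_mem_whaleU_iff hd _).2 ⟨Finset.mem_insert_of_mem hmem, ?_⟩, fun h => ?_⟩
    · rw [Finset.card_insert_of_notMem hi]
      omega
    · exact hi (Finset.insert_eq_self.1 (indicator_one_injective d h))

/-- The degree from below of the vertex p(U_d^k) equals C(d−1, k−1). -/
theorem whaleU_degree_below (d k : ℕ) (hd : 2 ≤ d) (hk1 : 1 ≤ k) (hk2 : k ≤ d - 1) :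
    {g ∈ whaleU d k (by omega) |
      IsWhaleVertex d (whaleSum (whaleU d k (by omega) \ {g}))}.ncard =
      (d - 1).choose (k - 1) := by
  classical
  have hd0 : 0 < d := by omega
  set l : Fin d := ⟨d - 1, Nat.sub_lt hd0 one_pos⟩ with hl
  have hset : {g ∈ whaleU d k hd0 | IsWhaleVertex d (whaleSum (whaleU d k hd0 \ {g}))} =
      (fun A : Finset (Fin d) => (((insert l A : Finset (Fin d)) : Set (Fin d)).indicator 1 :
        Fin d → ℝ)) '' (Finset.powersetCard (k - 1) (Finset.univ.erase l)) := by
    ext g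
    constructor
    · rintro ⟨hgU, hv⟩
      obtain ⟨B, -, rfl⟩ := mem_whaleGens_iff.1 hgU.1
      obtain ⟨hlB, hB⟩ := (indicator_mem_whaleU_iff hd0 B).1 hgU
      have hcard : B.card = k := by
        by_contra hne
        exact not_isWhaleVertex_whaleU_diff hd0 (by omega) hlB (by omega) hv
      refine ⟨B.erase l, ?_, ?_⟩
      · rw [Finset.mem_coe, Finset.mem_powersetCard]
        exact ⟨Finset.erase_subset_erase l (Finset.subset_univ B), by
          rw [Finset.card_erase_of_mem hlB, hcard]⟩
      · simp only [hl, Finset.insert_erase hlB]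
    · rintro ⟨A, hA, rfl⟩
      rw [Finset.mem_coe, Finset.mem_powersetCard] at hA
      have hlA : l ∉ A := fun h => Finset.notMem_erase l _ (hA.1 h)
      have hcard : (insert l A).card = k := by
        rw [Finset.card_insert_of_notMem hlA]
        omega
      exact ⟨(indicator_mem_whaleU_iff hd0 _).2 ⟨Finset.mem_insert_self l A, hcard.le⟩,
        isWhaleVertex_whaleU_diff hd0 (Finset.mem_insert_self l A) hcard⟩
  rw [hset, Set.InjOn.ncard_image, Set.ncard_coe_finset, Finset.card_powersetCard,
    Finset.card_erase_of_mem (Finset.mem_univ l), Finset.card_univ, Fintype.card_fin]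
  intro A hA C hC h
  rw [Finset.mem_coe, Finset.mem_powersetCard] at hA hC
  have hlA : l ∉ A := fun h => Finset.notMem_erase l _ (hA.1 h)
  have hlC : l ∉ C := fun h => Finset.notMem_erase l _ (hC.1 h)
  rw [← Finset.erase_insert hlA, ← Finset.erase_insert hlC, indicator_one_injective d h]
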